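/- arXiv:2106.07373 — 5 statements merged into one kernel-verified Lean document; each statement's English description precedes it below -/
import Mathlib

section
/- Let N be a square-free positive integer that is a congruent number, represented by a right triangle with rational legs α = α₁/α₂ and β = β₁/β₂, where α₁, α₂, β₁, β₂ are positive integers with gcd(α₁, α₂) = 1 and gcd(β₁, β₂) = 1, such that α·β = 2N and α² + β² is the square of a rational number. Then gcd(α₁, β₁) = 1, gcd(α₂, β₂) = 1, and α₁ and β₁ have opposite parities (one is even and one is odd). -/
/-- The sum of two odd squares is not a square. -/
theorem not_isSquare_sq_add_sq_of_odd {x y : ℕ} (hx : Odd x) (hy : Odd y) :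
    ¬ IsSquare (x ^ 2 + y ^ 2) := by
  rintro ⟨d, hd⟩
  have h1 : x ^ 2 % 4 = 1 := by
    rw [Nat.pow_mod]
    have : x % 4 = 1 ∨ x % 4 = 3 := by have := Nat.odd_iff.1 hx; omega
    rcases this with h | h <;> simp [h]
  have h2 : y ^ 2 % 4 = 1 := by
    rw [Nat.pow_mod]
    have : y % 4 = 1 ∨ y % 4 = 3 := by have := Nat.odd_iff.1 hy; omega
    rcases this with h | h <;> simp [h]
  have h3 : d * d % 4 = 0 ∨ d * d % 4 = 1 := by
    rw [Nat.mul_mod]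
    have : d % 4 < 4 := Nat.mod_lt _ (by norm_num)
    interval_cases d % 4 <;> simp
  omega

/-- Clearing denominators in a sum of two rational squares that is a square. -/
theorem isSquare_of_div_sq_add_div_sq {a b c d : ℕ} (hb : 0 < b) (hd : 0 < d)
    (h : ∃ γ : ℚ, ((a : ℚ) / b) ^ 2 + ((c : ℚ) / d) ^ 2 = γ ^ 2) :
    IsSquare ((a * d) ^ 2 + (c * b) ^ 2) := by
  obtain ⟨γ, hγ⟩ := h
  rw [← Rat.isSquare_natCast_iff]
  refine ⟨γ * b * d, ?_⟩
  have hb' : (b : ℚ) ≠ 0 := by positivity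
  have hd' : (d : ℚ) ≠ 0 := by positivity
  calc (((a * d) ^ 2 + (c * b) ^ 2 : ℕ) : ℚ)
      = (((a : ℚ) / b) ^ 2 + ((c : ℚ) / d) ^ 2) * (b * d) ^ 2 := by
        push_cast
        field_simp
    _ = γ * b * d * (γ * b * d) := by
        rw [hγ]
        ring

/-- If `N` is a square-free positive integer that is a congruent number
represented with perpendicular sides `α₁/α₂` and `β₁/β₂` in reduced form (so that
`(α₁/α₂)·(β₁/β₂) = 2N` and `(α₁/α₂)² + (β₁/β₂)²` is a rational square), then
`gcd(α₁, β₁) = 1`, `gcd(α₂, β₂) = 1`, and `α₁`, `β₁` have opposite parities. -/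
theorem stmt0 (N a1 a2 b1 b2 : ℕ)
    (hN : 0 < N) (hsf : Squarefree N)
    (ha1 : 0 < a1) (ha2 : 0 < a2) (hb1 : 0 < b1) (hb2 : 0 < b2)
    (hredA : Nat.Coprime a1 a2) (hredB : Nat.Coprime b1 b2)
    (harea : ((a1 : ℚ) / a2) * ((b1 : ℚ) / b2) = 2 * N)
    (hhyp : ∃ γ : ℚ, ((a1 : ℚ) / a2) ^ 2 + ((b1 : ℚ) / b2) ^ 2 = γ ^ 2) :
    Nat.Coprime a1 b1 ∧ Nat.Coprime a2 b2 ∧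
      ((Even a1 ∧ Odd b1) ∨ (Odd a1 ∧ Even b1)) := by
  have hprod : a1 * b1 = 2 * N * (a2 * b2) := by
    have ha2' : (a2 : ℚ) ≠ 0 := by positivity
    have hb2' : (b2 : ℚ) ≠ 0 := by positivity
    rw [div_mul_div_comm, div_eq_iff (mul_ne_zero ha2' hb2')] at harea
    exact_mod_cast harea
  have hsq := isSquare_of_div_sq_add_div_sq ha2 hb2 hhyp
  have hnot_even : ¬ (2 ∣ a1 ∧ 2 ∣ b1) := by
    rintro ⟨⟨u, rfl⟩, ⟨v, rfl⟩⟩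
    have ha2odd : Odd a2 := (Nat.coprime_two_left).1 hredA.coprime_mul_right
    have hb2odd : Odd b2 := (Nat.coprime_two_left).1 hredB.coprime_mul_right
    have huv : 2 * (u * v) = N * (a2 * b2) := by linarith
    obtain ⟨M, rfl⟩ : 2 ∣ N := by
      refine Nat.Coprime.dvd_of_dvd_mul_right ?_ (huv ▸ dvd_mul_right 2 (u * v))
      exact Nat.coprime_two_left.2 (ha2odd.mul hb2odd)
    have hM : Odd M := by
      rw [← Nat.not_even_iff_odd, even_iff_two_dvd]
      intro h
      exact absurd (hsf 2 (mul_dvd_mul_left 2 h)) (by decide)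
    have huv' : u * v = M * (a2 * b2) := by linarith
    have huvodd : Odd (u * v) := huv' ▸ hM.mul (ha2odd.mul hb2odd)
    obtain ⟨hu, hv⟩ := Nat.odd_mul.1 huvodd
    obtain ⟨c, hc⟩ := hsq
    obtain ⟨d, rfl⟩ : 2 ∣ c := by
      have : 2 ∣ c * c := hc ▸ ⟨2 * ((u * b2) ^ 2 + (v * a2) ^ 2), by ring⟩
      exact (Nat.prime_two.dvd_mul.1 this).elim id id
    exact not_isSquare_sq_add_sq_of_odd (hu.mul hb2odd) (hv.mul ha2odd) ⟨d, by linarith⟩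
  have hcop1 : Nat.Coprime a1 b1 := by
    refine Nat.coprime_of_dvd fun p hp hpa hpb => ?_
    rcases hp.eq_two_or_odd' with rfl | hodd
    · exact hnot_even ⟨hpa, hpb⟩
    have hpp : p * p ∣ N * (2 * (a2 * b2)) := by
      have heq : N * (2 * (a2 * b2)) = a1 * b1 := by
        rw [hprod]
        ring
      exact heq ▸ mul_dvd_mul hpa hpb
    have hcop : Nat.Coprime p (2 * (a2 * b2)) :=
      (Nat.coprime_two_right.2 hodd).mul_right
        ((hredA.coprime_dvd_left hpa).mul_right (hredB.coprime_dvd_left hpb))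
    exact hp.not_isUnit (hsf p ((hcop.mul_left hcop).dvd_of_dvd_mul_right hpp))
  refine ⟨hcop1, ?_, ?_⟩
  · refine Nat.coprime_of_dvd fun p hp hpa hpb => ?_
    have hpab : p ∣ a1 * b1 := hprod ▸ (hpa.mul_right b2).mul_left (2 * N)
    rcases hp.dvd_mul.1 hpab with h | h
    · exact Nat.not_coprime_of_dvd_of_dvd hp.one_lt h hpa hredA
    · exact Nat.not_coprime_of_dvd_of_dvd hp.one_lt h hpb hredB
  · have heven : 2 ∣ a1 * b1 := ⟨N * (a2 * b2), by rw [hprod]; ring⟩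
    rcases Nat.prime_two.dvd_mul.1 heven with h | h <;>
      simp only [even_iff_two_dvd, ← Nat.not_even_iff_odd] <;> tauto
end

section
/- Let N be a square-free positive integer and let P, Q, m be positive integers with gcd(P, Q) = 1, P > Q, and P·Q·(P − Q)·(P + Q) = N·m². Then there exist positive integers P₀, P₁, Q₀, Q₁ such that P = P₀·P₁², Q = Q₀·Q₁², and P₀·Q₀ divides N. -/
/-- If `a * c ^ 2` and `b` are coprime with product `N * m ^ 2` and `a` is square-free,
then `a` divides `N`. -/
theorem Squarefree.dvd_of_mul_sq_mul_eq_mul_sq {a b c m N : ℕ} (ha : Squarefree a)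
    (hc : c ≠ 0) (hb : b ≠ 0) (hN : N ≠ 0) (hm : m ≠ 0)
    (hco : Nat.Coprime (a * c ^ 2) b) (h : a * c ^ 2 * b = N * m ^ 2) : a ∣ N := by
  rw [← Nat.factorization_le_iff_dvd ha.ne_zero hN]
  intro p
  have hle := ha.natFactorization_le_one p
  have hval := congrArg (fun n => n.factorization p) h
  simp only [Nat.factorization_mul (mul_ne_zero ha.ne_zero (pow_ne_zero 2 hc)) hb,
    Nat.factorization_mul ha.ne_zero (pow_ne_zero 2 hc),
    Nat.factorization_mul hN (pow_ne_zero 2 hm), Nat.factorization_pow,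
    Finsupp.add_apply, Finsupp.smul_apply, smul_eq_mul] at hval
  by_cases hp : a.factorization p = 0
  · omega
  have hpa : p ∣ a := Nat.dvd_of_factorization_pos hp
  have hpp : p.Prime := by
    by_contra hnp
    exact hp (Nat.factorization_eq_zero_of_not_prime a hnp)
  have hpb : ¬ p ∣ b := fun hpb =>
    Nat.not_coprime_of_dvd_of_dvd hpp.one_lt (hpa.mul_right _) hpb hco
  have hb0 := Nat.factorization_eq_zero_of_not_dvd hpb
  omega

/-- If `N` is square-free, `gcd(P, Q) = 1`, `P > Q`, and
`PQ(P − Q)(P + Q) = N·m²`, then `P = P₀P₁²`, `Q = Q₀Q₁²` with `P₀Q₀ ∣ N`. -/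
theorem stmt8 (N P Q m : ℕ)
    (hN : 0 < N) (hsf : Squarefree N)
    (hP : 0 < P) (hQ : 0 < Q) (hm : 0 < m)
    (hco : Nat.Coprime P Q) (hPQ : Q < P)
    (heq : P * Q * (P - Q) * (P + Q) = N * m ^ 2) :
    ∃ P0 P1 Q0 Q1 : ℕ, 0 < P0 ∧ 0 < P1 ∧ 0 < Q0 ∧ 0 < Q1 ∧
      P = P0 * P1 ^ 2 ∧ Q = Q0 * Q1 ^ 2 ∧ P0 * Q0 ∣ N := by
  obtain ⟨P0, P1, hP0, hP1, hPeq, hPsf⟩ := Nat.sq_mul_squarefree_of_pos hP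
  obtain ⟨Q0, Q1, hQ0, hQ1, hQeq, hQsf⟩ := Nat.sq_mul_squarefree_of_pos hQ
  rw [mul_comm] at hPeq hQeq
  refine ⟨P0, P1, Q0, Q1, hP0, hP1, hQ0, hQ1, hPeq.symm, hQeq.symm, ?_⟩
  have hsub : 0 < P - Q := Nat.sub_pos_of_lt hPQ
  have hPsub : Nat.Coprime P (P - Q) := (Nat.coprime_self_sub_right hPQ.le).2 hco
  have hQsub : Nat.Coprime Q (P - Q) := (Nat.coprime_sub_self_right hPQ.le).2 hco.symm
  have hPadd : Nat.Coprime P (P + Q) := Nat.coprime_self_add_right.2 hco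
  have hQadd : Nat.Coprime Q (P + Q) := Nat.coprime_add_self_right.2 hco.symm
  have hco0 : Nat.Coprime P0 Q0 :=
    Nat.Coprime.of_dvd ⟨_, hPeq.symm⟩ ⟨_, hQeq.symm⟩ hco
  refine hco0.mul_dvd_of_dvd_of_dvd ?_ ?_
  · refine hPsf.dvd_of_mul_sq_mul_eq_mul_sq (b := Q * (P - Q) * (P + Q)) hP1.ne'
      (by positivity) hN.ne' hm.ne' ?_ ?_
    · rw [hPeq]
      exact (hco.mul_right hPsub).mul_right hPadd
    · rw [hPeq, ← heq]
      ring
  · refine hQsf.dvd_of_mul_sq_mul_eq_mul_sq (b := P * (P - Q) * (P + Q)) hQ1.ne'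
      (by positivity) hN.ne' hm.ne' ?_ ?_
    · rw [hQeq]
      exact (hco.symm.mul_right hQsub).mul_right hQadd
    · rw [hQeq, ← heq]
      ring
end

section
/- Let N be a square-free positive integer, let α₁, α₂, β₁, β₂ be positive integers with gcd(α₁, α₂) = 1, gcd(β₁, β₂) = 1, and α₁·β₁ = 2N·α₂·β₂, and suppose (α₁/α₂)² + (β₁/β₂)² is the square of a rational number. Then gcd(α₁·β₂, α₂·β₁) = 1; that is, the Pythagorean triple (α₁β₂, α₂β₁, C) with (α₁β₂)² + (α₂β₁)² = C² is primitive. -/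
theorem isSquare_cross_mul_sq_add_sq {a1 a2 b1 b2 : ℕ} (ha2 : 0 < a2) (hb2 : 0 < b2)
    (h : ∃ γ : ℚ, ((a1 : ℚ) / a2) ^ 2 + ((b1 : ℚ) / b2) ^ 2 = γ ^ 2) :
    IsSquare ((a1 * b2) ^ 2 + (a2 * b1) ^ 2) := by
  obtain ⟨γ, hγ⟩ := h
  rw [← Rat.isSquare_natCast_iff]
  refine ⟨γ * (a2 * b2), ?_⟩
  have ha : (a2 : ℚ) ≠ 0 := by positivity
  have hb : (b2 : ℚ) ≠ 0 := by positivity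
  calc (((a1 * b2) ^ 2 + (a2 * b1) ^ 2 : ℕ) : ℚ)
      = (((a1 : ℚ) / a2) ^ 2 + ((b1 : ℚ) / b2) ^ 2) * (a2 * b2) ^ 2 := by
        push_cast
        field_simp
    _ = γ * (a2 * b2) * (γ * (a2 * b2)) := by
        rw [hγ]
        ring

theorem not_isSquare_two_mul_odd_sq_add_two_mul_odd_sq {x y : ℕ} (hx : Odd x) (hy : Odd y) :
    ¬ IsSquare ((2 * x) ^ 2 + (2 * y) ^ 2) := by
  rintro ⟨c, hc⟩
  have hsq4 {z : ℕ} (hz : Odd z) : z ^ 2 % 4 = 1 := by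
    obtain ⟨k, rfl⟩ := hz
    ring_nf
    omega
  have hx4 := hsq4 hx
  have hy4 := hsq4 hy
  have hc16 : c * c % 16 = 0 ∨ c * c % 16 = 1 ∨ c * c % 16 = 4 ∨ c * c % 16 = 9 := by
    have : c % 16 < 16 := Nat.mod_lt _ (by norm_num)
    rw [Nat.mul_mod]
    interval_cases c % 16 <;> simp
  rw [mul_pow, mul_pow] at hc
  omega


/-- For square-free `N` with reduced legs `α₁/α₂`, `β₁/β₂`
satisfying `α₁·β₁ = 2N·α₂·β₂` and `(α₁/α₂)² + (β₁/β₂)²` a rational square,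
the triple `(α₁β₂, α₂β₁, C)` is a primitive Pythagorean triple, i.e.
`gcd(α₁β₂, α₂β₁) = 1`. -/
theorem stmt9 (N a1 a2 b1 b2 : ℕ)
    (hN : 0 < N) (hsf : Squarefree N)
    (ha1 : 0 < a1) (ha2 : 0 < a2) (hb1 : 0 < b1) (hb2 : 0 < b2)
    (hredA : Nat.Coprime a1 a2) (hredB : Nat.Coprime b1 b2)
    (heq : a1 * b1 = 2 * N * (a2 * b2))
    (hhyp : ∃ γ : ℚ, ((a1 : ℚ) / a2) ^ 2 + ((b1 : ℚ) / b2) ^ 2 = γ ^ 2) :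
    Nat.Coprime (a1 * b2) (a2 * b1) := by
  refine Nat.coprime_of_dvd fun p hp hA hB => ?_
  have hnA : p ∣ a1 → ¬ p ∣ a2 := fun h h' => Nat.not_coprime_of_dvd_of_dvd hp.one_lt h h' hredA
  have hnB : p ∣ b1 → ¬ p ∣ b2 := fun h h' => Nat.not_coprime_of_dvd_of_dvd hp.one_lt h h' hredB
  have h1 : p ∣ a1 ∧ p ∣ b1 := by
    have hdvd : p ∣ b2 → p ∣ a1 ∨ p ∣ b1 := fun h =>
      hp.dvd_mul.1 (heq ▸ Dvd.dvd.mul_left (h.mul_left a2) (2 * N))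
    rcases hp.dvd_mul.1 hA with h | h <;> rcases hp.dvd_mul.1 hB with h' | h' <;> tauto
  obtain ⟨⟨u, rfl⟩, ⟨v, rfl⟩⟩ := h1
  have hpa2 : p.Coprime a2 := (hp.coprime_iff_not_dvd).2 (hnA (dvd_mul_right p u))
  have hpb2 : p.Coprime b2 := (hp.coprime_iff_not_dvd).2 (hnB (dvd_mul_right p v))
  have hpp : p * p ∣ 2 * N := by
    refine Nat.Coprime.dvd_of_dvd_mul_right (k := p * p) (n := a2 * b2) ?_ ⟨u * v, ?_⟩
    · exact (hpa2.mul_right hpb2).mul_left (hpa2.mul_right hpb2)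
    · rw [← heq]
      ring
  have hNp : ¬ p * p ∣ N := fun h => hp.one_lt.ne' (Nat.isUnit_iff.1 (hsf p h))
  obtain rfl : p = 2 := by
    by_contra hne
    have hc : p.Coprime 2 := (Nat.coprime_primes hp Nat.prime_two).2 hne
    exact hNp ((hc.mul_left hc).dvd_of_dvd_mul_left hpp)
  obtain ⟨M, rfl⟩ : 2 ∣ N := by omega
  have hM : Odd M := by
    rw [← Nat.not_even_iff_odd]
    exact fun h => hNp (Nat.mul_dvd_mul_left 2 h.two_dvd)
  have ha2odd : Odd a2 := Nat.coprime_two_left.1 hpa2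
  have hb2odd : Odd b2 := Nat.coprime_two_left.1 hpb2
  have huv : Odd (u * v) := by
    have : u * v = M * (a2 * b2) := by linarith
    rw [this]
    exact hM.mul (ha2odd.mul hb2odd)
  obtain ⟨hu, hv⟩ := Nat.odd_mul.1 huv
  refine not_isSquare_two_mul_odd_sq_add_two_mul_odd_sq (hu.mul hb2odd) (ha2odd.mul hv) ?_
  convert isSquare_cross_mul_sq_add_sq ha2 hb2 hhyp using 1
  ring
end

section
/- Let N be a positive integer, and suppose there exist rational numbers x and y with y ≠ 0 such that y² = x³ − N²·x. Then N is a congruent number: there exist positive rationals α, β, γ with α² + β² = γ² and α·β = 2N. -/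
/-- If there is a rational point `(x, y)` with `y ≠ 0` on the
curve `y² = x³ − N²x`, then `N` is a congruent number. -/
theorem stmt11 (N : ℕ) (hN : 0 < N)
    (h : ∃ x y : ℚ, y ≠ 0 ∧ y ^ 2 = x ^ 3 - (N : ℚ) ^ 2 * x) :
    ∃ α β γ : ℚ, 0 < α ∧ 0 < β ∧ 0 < γ ∧ α ^ 2 + β ^ 2 = γ ^ 2 ∧
      α * β = 2 * N := by
  obtain ⟨x, y, hy, hxy⟩ := h
  have hNq : (0 : ℚ) < N := by exact_mod_cast hN
  have hfac : y ^ 2 = x * (x ^ 2 - (N : ℚ) ^ 2) := by rw [hxy]; ring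
  have hprod : x * (x ^ 2 - (N : ℚ) ^ 2) ≠ 0 := hfac ▸ pow_ne_zero 2 hy
  have hx : x ≠ 0 := left_ne_zero_of_mul hprod
  have hd : x ^ 2 - (N : ℚ) ^ 2 ≠ 0 := right_ne_zero_of_mul hprod
  have hs : x ^ 2 + (N : ℚ) ^ 2 ≠ 0 := by positivity
  refine ⟨|(x ^ 2 - (N : ℚ) ^ 2) / y|, |2 * N * x / y|, |(x ^ 2 + (N : ℚ) ^ 2) / y|,
    by positivity, by positivity, by positivity, ?_, ?_⟩
  · simp only [sq_abs]
    field_simp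
    ring
  · have hmul : (x ^ 2 - (N : ℚ) ^ 2) / y * (2 * N * x / y) = 2 * N := by
      field_simp
      linear_combination -hfac
    rw [← abs_mul, hmul, abs_of_pos (by positivity)]
end

section
/- Let N be a positive integer and let x, y be rational numbers satisfying y² = x³ − N²·x. Then (x² + N²)² + 4N·y² = (x² + 2N·x − N²)² and (x² + N²)² − 4N·y² = (x² − 2N·x − N²)². In particular, if y ≠ 0, then x′ = ((x² + N²)/(2y))² satisfies that both x′ + N and x′ − N are squares of rational numbers. -/
/-- For rational `x, y` with `y² = x³ − N²x`, the identities
`(x² + N²)² + 4Ny² = (x² + 2Nx − N²)²` and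
`(x² + N²)² − 4Ny² = (x² − 2Nx − N²)²` hold; in particular, if `y ≠ 0`, then
`x′ = ((x² + N²)/(2y))²` satisfies that both `x′ + N` and `x′ − N` are rational
squares. -/
theorem stmt12 (N : ℕ) (hN : 0 < N) (x y : ℚ)
    (h : y ^ 2 = x ^ 3 - (N : ℚ) ^ 2 * x) :
    (x ^ 2 + (N : ℚ) ^ 2) ^ 2 + 4 * N * y ^ 2
        = (x ^ 2 + 2 * N * x - (N : ℚ) ^ 2) ^ 2 ∧
    (x ^ 2 + (N : ℚ) ^ 2) ^ 2 - 4 * N * y ^ 2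
        = (x ^ 2 - 2 * N * x - (N : ℚ) ^ 2) ^ 2 ∧
    (y ≠ 0 →
      (∃ r : ℚ, ((x ^ 2 + (N : ℚ) ^ 2) / (2 * y)) ^ 2 + N = r ^ 2) ∧
      (∃ s : ℚ, ((x ^ 2 + (N : ℚ) ^ 2) / (2 * y)) ^ 2 - N = s ^ 2)) := by
  have hadd : (x ^ 2 + (N : ℚ) ^ 2) ^ 2 + 4 * N * y ^ 2
      = (x ^ 2 + 2 * N * x - (N : ℚ) ^ 2) ^ 2 := by
    rw [h]; ring
  have hsub : (x ^ 2 + (N : ℚ) ^ 2) ^ 2 - 4 * N * y ^ 2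
      = (x ^ 2 - 2 * N * x - (N : ℚ) ^ 2) ^ 2 := by
    rw [h]; ring
  refine ⟨hadd, hsub, fun hy => ⟨⟨(x ^ 2 + 2 * N * x - (N : ℚ) ^ 2) / (2 * y), ?_⟩,
    ⟨(x ^ 2 - 2 * N * x - (N : ℚ) ^ 2) / (2 * y), ?_⟩⟩⟩
  · rw [div_pow _ (2 * y), div_pow _ (2 * y), ← hadd]
    field_simp
    ring
  · rw [div_pow _ (2 * y), div_pow _ (2 * y), ← hsub]
    field_simp
    ring
end
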